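/- Let P(λ) = A_m λ^m + ⋯ + A_1 λ + A_0 be an n×n complex matrix polynomial with det A_m ≠ 0, let w_0, w_1, …, w_m be nonnegative reals with w_0 > 0, and set w(t) = w_m t^m + ⋯ + w_1 t + w_0. Suppose λ0 is a simple eigenvalue of P (a root of det P(λ) of multiplicity exactly 1), that P'(λ0) is invertible, and that x0, y0 ∈ ℂ^n are unit right and left eigenvectors of P at λ0. Assume moreover that the vector P'(λ0)* y0 is not a scalar multiple of x0. Put δ = y0* P'(λ0) x0 and ε* = ‖P'(λ0)‖ · ‖P'(λ0)^{−1}‖ · ‖P(λ0)‖ · |δ| / ( w(|λ0|) · ( ‖P'(λ0)* y0‖² − |δ|² )^{1/2} ). Then there exist matrices Δ_0, Δ_1, …, Δ_m ∈ ℂ^{n×n} with ‖Δ_j‖ ≤ ε* w_j for every j = 0, …, m such that λ0 is a multiple eigenvalue of the perturbed matrix polynomial Q(λ) = Σ_{j=0}^m (A_j + Δ_j) λ^j, i.e. λ0 is a root of det Q(λ) of multiplicity at least 2. (In particular, the distance dist(P,λ0) = inf{ε > 0 : some Q with ‖Δ_j‖ ≤ ε w_j has λ0 as a multiple eigenvalue}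 is at most ε*.) -/

import Mathlib

noncomputable section

open Matrix

/-- Euclidean norm of a complex vector. -/
def enorm2 {n : ℕ} (x : Fin n → ℂ) : ℝ := Real.sqrt (∑ i, ‖x i‖ ^ 2)

/-- Spectral norm: the operator norm induced by the Euclidean vector norm. -/
def specNorm {n : ℕ} (A : Matrix (Fin n) (Fin n) ℂ) : ℝ :=
  sSup {r : ℝ | ∃ x : Fin n → ℂ, enorm2 x = 1 ∧ r = enorm2 (A.mulVec x)}

/-- Smallest singular value: the minimum of `‖A x‖` over Euclidean-unit vectors `x`. -/
def sminSV {n : ℕ} (A : Matrix (Fin n) (Fin n) ℂ) : ℝ :=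
  sInf {r : ℝ | ∃ x : Fin n → ℂ, enorm2 x = 1 ∧ r = enorm2 (A.mulVec x)}

/-- Evaluation of the matrix polynomial `P(z) = ∑ A_j z^j`. -/
def evalP {n m : ℕ} (A : Fin (m+1) → Matrix (Fin n) (Fin n) ℂ) (z : ℂ) :
    Matrix (Fin n) (Fin n) ℂ :=
  ∑ j : Fin (m+1), z ^ (j : ℕ) • A j

/-- Derivative `P'(z) = ∑_{j≥1} j A_j z^(j-1)`. -/
def derivP {n m : ℕ} (A : Fin (m+1) → Matrix (Fin n) (Fin n) ℂ) (z : ℂ) :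
    Matrix (Fin n) (Fin n) ℂ :=
  ∑ j : Fin (m+1), (((j : ℕ) : ℂ) * z ^ ((j : ℕ) - 1)) • A j

/-- The scalar polynomial `det P(λ)`. -/
def detPoly {n m : ℕ} (A : Fin (m+1) → Matrix (Fin n) (Fin n) ℂ) : Polynomial ℂ :=
  (Matrix.of fun i k => ∑ j : Fin (m+1), Polynomial.C (A j i k) * Polynomial.X ^ (j : ℕ)).det

/-- The weight polynomial `w(t) = ∑ w_j t^j`. -/
def wval {m : ℕ} (w : Fin (m+1) → ℝ) (t : ℝ) : ℝ := ∑ j : Fin (m+1), w j * t ^ (j : ℕ)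

lemma detPoly_eval {n m : ℕ} (A : Fin (m+1) → Matrix (Fin n) (Fin n) ℂ) (z : ℂ) :
    (detPoly A).eval z = (evalP A z).det := by
  unfold detPoly
  rw [← Polynomial.coe_evalRingHom, RingHom.map_det]
  congr 1
  ext i k
  simp [evalP, Matrix.sum_apply, Polynomial.eval_finsetSum]
  exact Finset.sum_congr rfl fun j _ => by ring

lemma dbl {n m : ℕ} (A : Fin (m+1) → Matrix (Fin n) (Fin n) ℂ) (z : ℂ)
    (hne : detPoly A ≠ 0) (x y : Fin n → ℂ) (hx0 : x ≠ 0) (hy0 : y ≠ 0)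
    (hx : (evalP A z).mulVec x = 0) (hy : Matrix.vecMul y (evalP A z) = 0)
    (hd : y ⬝ᵥ (derivP A z).mulVec x = 0) :
    2 ≤ Polynomial.rootMultiplicity z (detPoly A) := by
  rw [Polynomial.le_rootMultiplicity_iff hne]
  obtain ⟨k, hk⟩ := Function.ne_iff.mp hx0
  simp only [Pi.zero_apply] at hk
  set Q : Matrix (Fin n) (Fin n) (Polynomial ℂ) :=
    Matrix.of fun i k => ∑ j : Fin (m+1), Polynomial.C (A j i k) * Polynomial.X ^ (j : ℕ) with hQ
  have hdet : detPoly A = Q.det := rfl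
  have hQe : ∀ i k, (Q i k).eval z = evalP A z i k := by
    intro i k
    simp [hQ, evalP, Matrix.sum_apply, Polynomial.eval_finsetSum]
    exact Finset.sum_congr rfl fun j _ => by ring
  have hQd : ∀ i k, (Polynomial.derivative (Q i k)).eval z = derivP A z i k := by
    intro i k
    simp [hQ, derivP, Matrix.sum_apply, Polynomial.eval_finsetSum, Polynomial.derivative_X_pow]
    exact Finset.sum_congr rfl fun j _ => by ring
  set q : Fin n → Polynomial ℂ := Q.mulVec (fun i => Polynomial.C (x i)) with hq
  have hqe : ∀ i, (q i).eval z = 0 := by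
    intro i
    have := congrFun hx i
    simpa [hq, Matrix.mulVec, dotProduct, Polynomial.eval_finsetSum, hQe] using this
  have hqd : ∀ i, (Polynomial.derivative (q i)).eval z = (derivP A z).mulVec x i := by
    intro i
    simp [hq, Matrix.mulVec, dotProduct, Polynomial.eval_finsetSum, hQd]
  have hdv : ∀ i, ∃ r, q i = (Polynomial.X - Polynomial.C z) * r := fun i =>
    Polynomial.dvd_iff_isRoot.mpr (hqe i)
  choose r hr using hdv
  have hre : ∀ i, (r i).eval z = (derivP A z).mulVec x i := by
    intro i
    rw [← hqd i, hr i]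
    simp
  have hcr : Q.det * Polynomial.C (x k) =
      (Polynomial.X - Polynomial.C z) * (Q.updateCol k r).det := by
    have h1 : Q.cramer q = Q.det • (fun i => Polynomial.C (x i)) := by
      rw [Matrix.cramer_eq_adjugate_mulVec, hq, Matrix.mulVec_mulVec, Matrix.adjugate_mul]
      simp [Matrix.smul_mulVec]
    have h2 : q = (Polynomial.X - Polynomial.C z) • r := by
      ext1 i; rw [hr i]; rfl
    rw [h2, map_smul] at h1
    have h3 := congrFun h1 k
    simp only [Pi.smul_apply, smul_eq_mul, Matrix.cramer_apply] at h3
    exact h3.symm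
  have hroot : ((Q.updateCol k r).det).eval z = 0 := by
    rw [← Polynomial.coe_evalRingHom, RingHom.map_det]
    apply Matrix.exists_vecMul_eq_zero_iff.mp
    refine ⟨y, hy0, ?_⟩
    ext l
    by_cases hl : l = k
    · subst hl
      simpa [Matrix.vecMul, dotProduct, hre] using hd
    · have := congrFun hy l
      simpa [Matrix.vecMul, dotProduct, hQe, Matrix.updateCol_ne hl] using this
  obtain ⟨s, hs⟩ := Polynomial.dvd_iff_isRoot.mpr hroot
  have hu : IsUnit (Polynomial.C (x k)) := Polynomial.isUnit_C.mpr (isUnit_iff_ne_zero.mpr hk)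
  rw [hdet, ← hu.dvd_mul_right, hcr, hs]
  exact ⟨s, by ring⟩

lemma detPoly_ne {n m : ℕ} (A : Fin (m+1) → Matrix (Fin n) (Fin n) ℂ)
    (h : (A (Fin.last m)).det ≠ 0) : detPoly A ≠ 0 := by
  intro h0
  set R : Fin (m+1) → Matrix (Fin n) (Fin n) ℂ := fun j => A (Fin.rev j) with hR
  have hR0 : detPoly R ≠ 0 := by
    intro h1
    have := detPoly_eval R 0
    rw [h1] at this
    apply h
    have e : evalP R 0 = A (Fin.last m) := by
      simp [evalP, Fin.sum_univ_succ, hR]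
    rw [e] at this
    simpa using this.symm
  apply hR0
  apply Polynomial.eq_zero_of_infinite_isRoot
  apply (Set.finite_singleton (0:ℂ)).infinite_compl.mono
  intro z hz
  have hz : z ≠ 0 := hz
  show (detPoly R).eval z = 0
  have h2 := detPoly_eval A z⁻¹
  rw [h0, Polynomial.eval_zero] at h2
  have e : evalP R z = z ^ m • evalP A z⁻¹ := by
    unfold evalP
    rw [Finset.smul_sum, ← Equiv.sum_comp Fin.revPerm]
    apply Finset.sum_congr rfl
    intro j _
    simp only [hR, Fin.revPerm_apply, Fin.rev_rev, smul_smul]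
    congr 1
    have : m = (Fin.rev j : ℕ) + (j:ℕ) := by
      rw [Fin.val_rev]; omega
    have h3 : z ^ m = z ^ (Fin.rev j : ℕ) * z ^ (j : ℕ) := by
      rw [← pow_add]; exact congrArg _ this
    rw [h3, inv_pow, mul_assoc, mul_inv_cancel₀ (pow_ne_zero _ hz), mul_one]
  rw [detPoly_eval, e, Matrix.det_smul, ← h2, mul_zero]

lemma enorm2_eq {n : ℕ} (x : Fin n → ℂ) : enorm2 x = ‖WithLp.toLp 2 x‖ := by
  rw [EuclideanSpace.norm_eq]; rfl

lemma enorm2_nonneg {n : ℕ} (x : Fin n → ℂ) : 0 ≤ enorm2 x := Real.sqrt_nonneg _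

lemma enorm2_smul {n : ℕ} (c : ℂ) (x : Fin n → ℂ) : enorm2 (c • x) = ‖c‖ * enorm2 x := by
  rw [enorm2_eq, enorm2_eq, WithLp.toLp_smul, norm_smul]

lemma enorm2_eq_zero {n : ℕ} (x : Fin n → ℂ) : enorm2 x = 0 ↔ x = 0 := by
  rw [enorm2_eq, norm_eq_zero, WithLp.toLp_eq_zero]

lemma dot_self {n : ℕ} (x : Fin n → ℂ) : star x ⬝ᵥ x = ((enorm2 x ^ 2 : ℝ) : ℂ) := by
  unfold enorm2
  rw [Real.sq_sqrt (by positivity)]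
  simp [dotProduct, Complex.conj_mul']

lemma dot_le {n : ℕ} (x y : Fin n → ℂ) : ‖star x ⬝ᵥ y‖ ≤ enorm2 x * enorm2 y := by
  have := norm_inner_le_norm (𝕜 := ℂ) (WithLp.toLp 2 x) (WithLp.toLp 2 y)
  rw [EuclideanSpace.inner_eq_star_dotProduct, dotProduct_comm] at this
  rw [enorm2_eq, enorm2_eq]
  exact this

open scoped Matrix.Norms.L2Operator in
lemma enorm2_mulVec_bdd {n : ℕ} (A : Matrix (Fin n) (Fin n) ℂ) :
    BddAbove {r : ℝ | ∃ x : Fin n → ℂ, enorm2 x = 1 ∧ r = enorm2 (A.mulVec x)} := by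
  refine ⟨‖A‖, ?_⟩
  rintro r ⟨x, hx, rfl⟩
  have := Matrix.l2_opNorm_mulVec A (WithLp.toLp 2 x)
  rw [← enorm2_eq x, hx, mul_one] at this
  rw [enorm2_eq]
  exact this

lemma specNorm_nonneg {n : ℕ} (A : Matrix (Fin n) (Fin n) ℂ) : 0 ≤ specNorm A := by
  apply Real.sSup_nonneg
  rintro r ⟨x, _, rfl⟩
  exact enorm2_nonneg _

lemma mulVec_le {n : ℕ} (A : Matrix (Fin n) (Fin n) ℂ) (x : Fin n → ℂ) :
    enorm2 (A.mulVec x) ≤ specNorm A * enorm2 x := by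
  by_cases hx : enorm2 x = 0
  · rw [(enorm2_eq_zero x).mp hx]
    simp [(enorm2_eq_zero (0 : Fin n → ℂ)).mpr rfl]
  have hp : 0 < enorm2 x := lt_of_le_of_ne (enorm2_nonneg x) (Ne.symm hx)
  have hn : ‖((enorm2 x : ℂ))⁻¹‖ = (enorm2 x)⁻¹ := by
    rw [norm_inv, Complex.norm_real, Real.norm_of_nonneg hp.le]
  have := le_csSup (enorm2_mulVec_bdd A) ⟨((enorm2 x : ℂ))⁻¹ • x, by
    rw [enorm2_smul, hn]; field_simp, rfl⟩
  rw [Matrix.mulVec_smul, enorm2_smul, hn, inv_mul_le_iff₀ hp] at this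
  rw [mul_comm]
  exact this

lemma specNorm_le {n : ℕ} (A : Matrix (Fin n) (Fin n) ℂ) (K : ℝ) (hK : 0 ≤ K)
    (h : ∀ x, enorm2 x = 1 → enorm2 (A.mulVec x) ≤ K) : specNorm A ≤ K := by
  apply Real.sSup_le _ hK
  rintro r ⟨x, hx, rfl⟩
  exact h x hx

lemma specNorm_smul_le {n : ℕ} (c : ℂ) (A : Matrix (Fin n) (Fin n) ℂ) :
    specNorm (c • A) ≤ ‖c‖ * specNorm A := by
  apply specNorm_le _ _ (mul_nonneg (norm_nonneg _) (specNorm_nonneg _))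
  intro x hx
  rw [Matrix.smul_mulVec, enorm2_smul]
  have := mulVec_le A x
  rw [hx, mul_one] at this
  gcongr

/-- Distribution of a perturbation `E` over the coefficients, keeping the determinant nonzero. -/
lemma distribute {n m : ℕ} (hm : m ≠ 0) (A : Fin (m+1) → Matrix (Fin n) (Fin n) ℂ)
    (hAm : (A (Fin.last m)).det ≠ 0)
    (w : Fin (m+1) → ℝ) (hw : ∀ j, 0 ≤ w j) (hw0 : 0 < w 0) (z : ℂ)
    (E : Matrix (Fin n) (Fin n) ℂ) (K : ℝ) (hK : specNorm E < K) :
    ∃ c : Fin (m+1) → ℂ, (∑ j, c j * z ^ (j:ℕ) = 1) ∧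
      (∀ j, specNorm (c j • E) ≤ K / wval w ‖z‖ * w j) ∧
      detPoly (fun j => A j + c j • E) ≠ 0 := by
  have hW : 0 < wval w ‖z‖ := by
    unfold wval
    apply Finset.sum_pos'
    · intro j _; have := hw j; positivity
    · exact ⟨0, Finset.mem_univ _, by simpa using hw0⟩
  set W := wval w ‖z‖ with hWd
  set c0 : Fin (m+1) → ℂ := fun j => ((w j / W : ℝ) : ℂ) * (star z / (‖z‖ : ℂ)) ^ (j:ℕ) with hc0
  have hphase : ‖star z / (‖z‖ : ℂ)‖ ≤ 1 := by
    rw [norm_div, norm_star, Complex.norm_real, norm_norm]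
    exact div_self_le_one _
  have hc0n : ∀ j, ‖c0 j‖ ≤ w j / W := by
    intro j
    have h1 : 0 ≤ w j / W := div_nonneg (hw j) hW.le
    simp only [hc0, norm_mul, norm_pow, Complex.norm_real, Real.norm_of_nonneg h1]
    exact mul_le_of_le_one_right h1 (pow_le_one₀ (norm_nonneg _) hphase)
  have hc0s : ∑ j, c0 j * z ^ (j:ℕ) = 1 := by
    have hz : star z / (‖z‖ : ℂ) * z = (‖z‖ : ℂ) := by
      by_cases h : z = 0
      · simp [h]
      have : (‖z‖ : ℂ) ≠ 0 := by simpa using h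
      have h2 : star z * z = (‖z‖ : ℂ)^2 := Complex.conj_mul' z
      field_simp
      exact h2
    have : ∀ j : Fin (m+1), c0 j * z ^ (j:ℕ) = ((w j * ‖z‖ ^ (j:ℕ) / W : ℝ) : ℂ) := by
      intro j
      simp only [hc0]
      rw [mul_assoc, ← mul_pow, hz]
      push_cast; ring
    simp_rw [this]
    rw [← Complex.ofReal_sum, ← Finset.sum_div]
    have : ∑ j : Fin (m+1), w j * ‖z‖ ^ (j:ℕ) = W := rfl
    rw [this, div_self hW.ne']; simp
  -- nondegeneracy at `τ = 1`
  set e0 : Fin (m+1) → ℂ := fun j => if j = 0 then 1 else 0 with he0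
  have h1 : detPoly (fun j => A j + e0 j • E) ≠ 0 := by
    apply detPoly_ne
    have : Fin.last m ≠ 0 := by
      intro h; apply hm; simpa using congrArg Fin.val h
    simpa [he0, this] using hAm
  obtain ⟨μ, hμ⟩ : ∃ μ, (detPoly (fun j => A j + e0 j • E)).eval μ ≠ 0 := by
    by_contra! hcon
    exact h1 (Polynomial.funext (by simpa using hcon))
  rw [detPoly_eval] at hμ
  have hadd : ∀ c : Fin (m+1) → ℂ, evalP (fun j => A j + c j • E) μ
      = evalP A μ + (∑ j, c j * μ ^ (j:ℕ)) • E := by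
    intro c
    simp only [evalP, smul_add, Finset.sum_add_distrib, smul_smul, Finset.sum_smul, mul_comm]
  have he0s : ∀ v : ℂ, ∑ j, e0 j * v ^ (j:ℕ) = 1 := by
    intro v; simp [he0]
  set s := ∑ j, c0 j * μ ^ (j:ℕ) with hs
  set G : Fin (1+1) → Matrix (Fin n) (Fin n) ℂ := ![evalP A μ + s • E, (1 - s) • E] with hG
  have hGe : ∀ t : ℂ, evalP G t = evalP A μ + (s + t * (1 - s)) • E := by
    intro t
    simp [evalP, hG, Fin.sum_univ_succ, add_smul, smul_smul, add_assoc]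
  have hGne : detPoly G ≠ 0 := by
    intro h
    have h2 := detPoly_eval G 1
    rw [h, hGe] at h2
    rw [hadd, he0s] at hμ
    apply hμ
    simpa using h2.symm
  -- choose a small parameter
  have hEn := specNorm_nonneg E
  set τ0 : ℝ := min 1 ((K - specNorm E) * (w 0 / W) / (specNorm E + 1)) with hτ0
  have hτ0p : 0 < τ0 := by
    apply lt_min one_pos
    have : 0 < K - specNorm E := sub_pos.mpr hK
    positivity
  obtain ⟨τ, hτ, hτe⟩ : ∃ τ ∈ Set.Ioo (0:ℝ) τ0, (detPoly G).eval (τ : ℂ) ≠ 0 := by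
    by_contra! hcon
    apply hGne
    apply Polynomial.eq_zero_of_infinite_isRoot
    apply ((Set.Ioo_infinite hτ0p).image (Complex.ofReal_injective.injOn)).mono
    rintro _ ⟨t, ht, rfl⟩
    exact hcon t ht
  have hτ1 : τ ≤ 1 := hτ.2.le.trans (min_le_left _ _)
  have hτ2 : τ * (specNorm E + 1) ≤ (K - specNorm E) * (w 0 / W) := by
    rw [← le_div_iff₀ (by positivity)]
    exact hτ.2.le.trans (min_le_right _ _)
  refine ⟨fun j => (1 - τ) * c0 j + τ * e0 j, ?_, ?_, ?_⟩
  · simp only [add_mul, Finset.sum_add_distrib, mul_assoc, ← Finset.mul_sum, hc0s, he0s]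
    ring
  · intro j
    refine (specNorm_smul_le _ _).trans ?_
    have hn1 : ‖(1 - (τ:ℂ)) * c0 j‖ ≤ w j / W := by
      rw [norm_mul]
      have : ‖(1 - (τ:ℂ))‖ = 1 - τ := by
        rw [← Complex.ofReal_one, ← Complex.ofReal_sub, Complex.norm_real,
          Real.norm_of_nonneg (by linarith)]
      rw [this]
      refine (mul_le_of_le_one_left (norm_nonneg _) (by linarith [hτ.1])).trans (hc0n j)
    have hwj : 0 ≤ w j / W := div_nonneg (hw j) hW.le
    have hR : K / W * w j = K * (w j / W) := by ring
    rw [hR]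
    by_cases hj : j = 0
    · subst hj
      have : ‖(1 - (τ:ℂ)) * c0 0 + τ * e0 0‖ ≤ w 0 / W + τ := by
        refine (norm_add_le _ _).trans (add_le_add hn1 ?_)
        simp [he0, abs_of_pos hτ.1]
      refine (mul_le_mul_of_nonneg_right this hEn).trans ?_
      nlinarith [hτ.1]
    · have : ‖(1 - (τ:ℂ)) * c0 j + τ * e0 j‖ ≤ w j / W := by
        simpa [he0, hj] using hn1
      refine (mul_le_mul_of_nonneg_right this hEn).trans ?_
      rw [mul_comm]
      exact mul_le_mul_of_nonneg_right hK.le hwj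
  · intro h
    apply hτe
    rw [detPoly_eval, hGe]
    have h2 := detPoly_eval (fun j => A j + ((1 - (τ:ℂ)) * c0 j + τ * e0 j) • E) μ
    rw [h, hadd] at h2
    simp only [add_mul, Finset.sum_add_distrib, mul_assoc, ← Finset.mul_sum, he0s, ← hs] at h2
    rw [Polynomial.eval_zero] at h2
    rw [h2]
    congr 3
    ring

lemma key {n : ℕ} (M B : Matrix (Fin n) (Fin n) ℂ) (hB : IsUnit B) (x y : Fin n → ℂ)
    (hx1 : enorm2 x = 1) (hx : M.mulVec x = 0) (hy : Matrix.vecMul (star y) M = 0)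
    (hns : ¬ ∃ c : ℂ, Bᴴ.mulVec y = c • x)
    (hsimp : ∀ y', y' ≠ 0 → Matrix.vecMul y' M = 0 → y' ⬝ᵥ B.mulVec x ≠ 0) (hy0 : y ≠ 0) :
    ∃ (E : Matrix (Fin n) (Fin n) ℂ) (y' : Fin n → ℂ), y' ≠ 0 ∧ E.mulVec x = 0 ∧
      Matrix.vecMul y' (M + E) = 0 ∧ y' ⬝ᵥ B.mulVec x = 0 ∧
      specNorm E < specNorm B * specNorm B⁻¹ * specNorm M * ‖star y ⬝ᵥ B.mulVec x‖ /
        Real.sqrt (enorm2 (Bᴴ.mulVec y) ^ 2 - ‖star y ⬝ᵥ B.mulVec x‖ ^ 2) := by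
  set δ := star y ⬝ᵥ B.mulVec x with hδ
  set u := Bᴴ.mulVec y with hu
  have hsu : star u = Matrix.vecMul (star y) B := by
    rw [hu, Matrix.star_mulVec, Matrix.conjTranspose_conjTranspose]
  have hBd : IsUnit B.det := (Matrix.isUnit_iff_isUnit_det B).mp hB
  have hux : star u ⬝ᵥ x = δ := by rw [hsu, ← Matrix.dotProduct_mulVec]
  have hxx : star x ⬝ᵥ x = 1 := by rw [dot_self, hx1]; simp
  have hδ0 : δ ≠ 0 := hsimp (star y) (by simpa using hy0) hy
  set v := u - (star δ) • x with hv
  have hsv : star v = star u - δ • star x := by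
    rw [hv, star_sub, star_smul, star_star]
  have hvx : star v ⬝ᵥ x = 0 := by
    rw [hsv, sub_dotProduct, smul_dotProduct, hux, hxx]; simp
  have hv0 : v ≠ 0 := fun h => hns ⟨star δ, sub_eq_zero.mp h⟩
  have hvn : enorm2 u ^ 2 - ‖δ‖ ^ 2 = enorm2 v ^ 2 := by
    have h1 : star v ⬝ᵥ v = star u ⬝ᵥ u - star δ * δ := by
      conv_lhs => rw [hv]
      rw [← hv, dotProduct_sub, dotProduct_smul, hvx, hsv, sub_dotProduct, smul_dotProduct]
      have : star x ⬝ᵥ u = star δ := by rw [← hux, Matrix.star_dotProduct]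
      rw [this]; simp [mul_comm]
    have h2 : star δ * δ = ((‖δ‖^2 : ℝ) : ℂ) := by
      push_cast; exact Complex.conj_mul' δ
    rw [dot_self, dot_self, h2] at h1
    exact_mod_cast h1.symm
  have hvp : 0 < enorm2 v := lt_of_le_of_ne (enorm2_nonneg v)
    (fun h => hv0 ((enorm2_eq_zero v).mp h.symm))
  rw [hvn, Real.sqrt_sq hvp.le]
  set C := B⁻¹ * M with hC
  set a := Cᴴ.mulVec x with ha
  have hsa : star a = Matrix.vecMul (star x) C := by
    rw [ha, Matrix.star_mulVec, Matrix.conjTranspose_conjTranspose]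
  have huC : Matrix.vecMul (star u) C = 0 := by
    rw [hsu, hC, Matrix.vecMul_vecMul, Matrix.mul_nonsing_inv_cancel_left _ _ hBd, hy]
  have hvC : Matrix.vecMul (star v) C = -(δ • star a) := by
    rw [hsv, Matrix.sub_vecMul, huC, Matrix.smul_vecMul, hsa, zero_sub]
  set y' := Matrix.vecMul (star v) B⁻¹ with hy'
  have hy'B : Matrix.vecMul y' B = star v := by
    rw [hy', Matrix.vecMul_vecMul, Matrix.nonsing_inv_mul _ hBd, Matrix.vecMul_one]
  have hy'0 : y' ≠ 0 := by
    intro h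
    rw [h, Matrix.zero_vecMul] at hy'B
    exact hv0 (by simpa using hy'B.symm)
  have hy'M : Matrix.vecMul y' M = -(δ • star a) := by
    rw [hy', Matrix.vecMul_vecMul, hvC]
  have hy'x : y' ⬝ᵥ B.mulVec x = 0 := by
    rw [Matrix.dotProduct_mulVec, hy'B, hvx]
  have ha0 : a ≠ 0 := by
    intro h
    exact hsimp y' hy'0 (by rw [hy'M, h]; simp) hy'x
  have hCx : C.mulVec x = 0 := by
    rw [hC, ← Matrix.mulVec_mulVec, hx, Matrix.mulVec_zero]
  have hCle : ∀ z, enorm2 (C.mulVec z) ≤ specNorm B⁻¹ * specNorm M * enorm2 z := by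
    intro z
    rw [hC, ← Matrix.mulVec_mulVec, mul_assoc]
    exact (mulVec_le _ _).trans (mul_le_mul_of_nonneg_left (mulVec_le _ _) (specNorm_nonneg _))
  have hap : 0 < enorm2 a := lt_of_le_of_ne (enorm2_nonneg a)
    (fun h => ha0 ((enorm2_eq_zero a).mp h.symm))
  -- strict inequality
  have hstrict : enorm2 a < specNorm B⁻¹ * specNorm M := by
    by_contra! hcon
    have h1 : enorm2 (C.mulVec a) ≤ enorm2 a ^ 2 := by
      refine (hCle a).trans ?_
      rw [sq]
      exact mul_le_mul_of_nonneg_right hcon hap.le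
    set b := C.mulVec a with hb
    set α : ℂ := ((enorm2 a ^ 2 : ℝ) : ℂ) with hα
    have hxb : star x ⬝ᵥ b = α := by
      rw [hb, Matrix.dotProduct_mulVec, ← hsa, dot_self]
    have hbx : star b ⬝ᵥ x = α := by
      have : star b ⬝ᵥ x = star (star x ⬝ᵥ b) := by
        rw [Matrix.star_dotProduct]
      rw [this, hxb, hα]; exact Complex.conj_ofReal _
    have h2 : star (b - α • x) ⬝ᵥ (b - α • x) = star b ⬝ᵥ b - α * α := by
      have hαs : star α = α := Complex.conj_ofReal _
      rw [star_sub, star_smul, hαs]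
      simp only [sub_dotProduct, dotProduct_sub, smul_dotProduct, dotProduct_smul, hxb, hbx, hxx,
        smul_eq_mul]
      ring
    rw [dot_self, dot_self, hα] at h2
    have h3 : enorm2 (b - α • x) ^ 2 = enorm2 b ^ 2 - enorm2 a ^ 2 * enorm2 a ^ 2 := by
      exact_mod_cast h2
    have h4 : enorm2 (b - α • x) = 0 := by
      have := enorm2_nonneg b
      have h5 : enorm2 (b - α • x) ^ 2 ≤ 0 := by rw [h3]; nlinarith
      exact pow_eq_zero_iff (two_ne_zero) |>.mp (le_antisymm h5 (sq_nonneg _))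
    have h5 : b = α • x := sub_eq_zero.mp ((enorm2_eq_zero _).mp h4)
    have h6 : star u ⬝ᵥ b = 0 := by
      rw [hb, Matrix.dotProduct_mulVec, huC, zero_dotProduct]
    rw [h5, dotProduct_smul, hux, smul_eq_mul] at h6
    rcases mul_eq_zero.mp h6 with h | h
    · rw [hα] at h
      have : enorm2 a ^ 2 = 0 := by exact_mod_cast h
      exact (pow_pos hap 2).ne' this
    · exact hδ0 h
  set β : ℂ := δ / ((enorm2 v ^ 2 : ℝ) : ℂ) with hβ
  have hβn : ‖β‖ = ‖δ‖ / enorm2 v ^ 2 := by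
    rw [hβ, norm_div, Complex.norm_real, Real.norm_of_nonneg (by positivity)]
  have hvc : ((enorm2 v ^ 2 : ℝ) : ℂ) ≠ 0 := by
    exact_mod_cast (pow_pos hvp 2).ne'
  have hBp : 0 < specNorm B := by
    apply lt_of_le_of_ne (specNorm_nonneg B)
    intro h
    have h1 := mulVec_le B x
    rw [← h, zero_mul] at h1
    have h2 := (enorm2_eq_zero _).mp (le_antisymm h1 (enorm2_nonneg _))
    apply hδ0
    rw [hδ, h2, dotProduct_zero]
  refine ⟨β • Matrix.vecMulVec (B.mulVec v) (star a), y', hy'0, ?_, ?_, hy'x, ?_⟩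
  · rw [Matrix.smul_mulVec, Matrix.vecMulVec_mulVec, hsa, ← Matrix.dotProduct_mulVec, hCx,
      dotProduct_zero]
    simp
  · rw [Matrix.vecMul_add, hy'M, Matrix.vecMul_smul, Matrix.vecMul_vecMulVec,
      Matrix.dotProduct_mulVec, hy'B, dot_self, smul_smul, hβ, div_mul_cancel₀ _ hvc]
    simp
  · have hδp : 0 < ‖δ‖ := norm_pos_iff.mpr hδ0
    have hle : specNorm (β • Matrix.vecMulVec (B.mulVec v) (star a)) ≤
        specNorm B * enorm2 a * ‖δ‖ / enorm2 v := by
      apply specNorm_le _ _ (by positivity)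
      intro z hz
      have e : (β • Matrix.vecMulVec (B.mulVec v) (star a)).mulVec z
          = (β * (star a ⬝ᵥ z)) • B.mulVec v := by
        rw [Matrix.smul_mulVec, Matrix.vecMulVec_mulVec, mul_smul]
        simp
      rw [e, enorm2_smul, norm_mul, hβn]
      have h1 := dot_le a z
      rw [hz, mul_one] at h1
      have h2 := mulVec_le B v
      calc ‖δ‖ / enorm2 v ^ 2 * ‖star a ⬝ᵥ z‖ * enorm2 (B.mulVec v)
          ≤ ‖δ‖ / enorm2 v ^ 2 * enorm2 a * (specNorm B * enorm2 v) := by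
            gcongr
            exact enorm2_nonneg _
        _ = _ := by field_simp
    refine hle.trans_lt ?_
    rw [mul_assoc (specNorm B)  (specNorm B⁻¹)]
    gcongr

/-- Theorem 4.2: upper bound for the distance from `P` to the matrix
polynomials having the simple eigenvalue `λ0` as a multiple eigenvalue: there is a
perturbation with `‖Δ_j‖ ≤ ε* w_j` for which `λ0` is a multiple eigenvalue. -/
theorem stmt1 {n m : ℕ} (A : Fin (m+1) → Matrix (Fin n) (Fin n) ℂ)
    (hAm : (A (Fin.last m)).det ≠ 0)
    (w : Fin (m+1) → ℝ) (hw : ∀ j, 0 ≤ w j) (hw0 : 0 < w 0)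
    (lam0 : ℂ)
    (hsimple : Polynomial.rootMultiplicity lam0 (detPoly A) = 1)
    (hP' : IsUnit (derivP A lam0))
    (x0 y0 : Fin n → ℂ)
    (hx1 : enorm2 x0 = 1) (hy1 : enorm2 y0 = 1)
    (hx : (evalP A lam0).mulVec x0 = 0)
    (hy : Matrix.vecMul (star y0) (evalP A lam0) = 0)
    (hns : ¬ ∃ c : ℂ, (derivP A lam0)ᴴ.mulVec y0 = c • x0) :
    ∃ Δ : Fin (m+1) → Matrix (Fin n) (Fin n) ℂ,
      (∀ j, specNorm (Δ j) ≤
          (specNorm (derivP A lam0) * specNorm (derivP A lam0)⁻¹ *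
              specNorm (evalP A lam0) *
              ‖star y0 ⬝ᵥ (derivP A lam0).mulVec x0‖ /
            (wval w (‖lam0‖) *
              Real.sqrt (enorm2 ((derivP A lam0)ᴴ.mulVec y0) ^ 2 -
                ‖star y0 ⬝ᵥ (derivP A lam0).mulVec x0‖ ^ 2))) * w j) ∧
      2 ≤ Polynomial.rootMultiplicity lam0 (detPoly (fun j => A j + Δ j)) := by
  have hn : ∀ v : Fin n → ℂ, enorm2 v = 1 → v ≠ 0 := by
    intro v h h0
    rw [(enorm2_eq_zero v).mpr h0] at h
    exact zero_ne_one h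
  have hx0 := hn x0 hx1
  have hy0 := hn y0 hy1
  have hne : detPoly A ≠ 0 := detPoly_ne A hAm
  have hm : m ≠ 0 := by
    rintro rfl
    apply hns
    refine ⟨0, ?_⟩
    simp [derivP]
  obtain ⟨E, y', hy'0, hEx, hy'E, hy'x, hE⟩ := key (evalP A lam0) (derivP A lam0) hP' x0 y0 hx1 hx hy
    hns (by
      intro y' h0 h1 h2
      have := dbl A lam0 hne x0 y' hx0 h0 hx h1 h2
      omega) hy0
  obtain ⟨c, hc1, hc2, hc3⟩ := distribute hm A hAm w hw hw0 lam0 E _ hE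
  refine ⟨fun j => c j • E, ?_, ?_⟩
  · intro j
    refine (hc2 j).trans (le_of_eq ?_)
    rw [div_div, mul_comm (wval w ‖lam0‖)]
  · have he : evalP (fun j => A j + c j • E) lam0 = evalP A lam0 + E := by
      have : evalP (fun j => A j + c j • E) lam0
        = evalP A lam0 + (∑ j, c j * lam0 ^ (j:ℕ)) • E := by
        simp only [evalP, smul_add, Finset.sum_add_distrib, smul_smul, Finset.sum_smul, mul_comm]
      rw [this, hc1, one_smul]
    have hd : derivP (fun j => A j + c j • E) lam0 = derivP A lam0 +
        (∑ j : Fin (m+1), (((j : ℕ) : ℂ) * lam0 ^ ((j : ℕ) - 1)) * c j) • E := by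
      simp only [derivP, smul_add, Finset.sum_add_distrib, smul_smul, Finset.sum_smul]
    refine dbl _ lam0 hc3 x0 y' hx0 hy'0 ?_ ?_ ?_
    · rw [he, Matrix.add_mulVec, hx, hEx, add_zero]
    · rw [he, hy'E]
    · rw [hd, Matrix.add_mulVec, Matrix.smul_mulVec, hEx, smul_zero, add_zero, hy'x]
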